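/- For every bipartite density matrix ρ_AB and every projective measurement {P_i} on A (mutually orthogonal orthogonal projectors of arbitrary rank summing to the identity) there exists a complete projective measurement {Q_j} refining {P_i} (each P_i is a sum of some of the Q_j) such that δ_cl^→(ρ_AB,{Q_j}) ≥ δ_cl^→(ρ_AB,{P_i}). In particular, the supremum defining Δ_cl^→ over all projective measurements equals the supremum over complete (rank-one) projective measurements. -/

import Mathlib

open Matrix Kronecker
open scoped ComplexOrder

noncomputable section

/-- von Neumann entropy (natural logarithm): `S(ρ) = -∑ λ_k log λ_k`. -/
def vnEntropy {d : ℕ} (ρ : Matrix (Fin d) (Fin d) ℂ) : ℝ :=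
  if h : ρ.IsHermitian then -∑ k, h.eigenvalues k * Real.log (h.eigenvalues k) else 0

/-- von Neumann entropy in bits (log base 2). -/
def vnEntropy2 {d : ℕ} (ρ : Matrix (Fin d) (Fin d) ℂ) : ℝ :=
  if h : ρ.IsHermitian then -∑ k, h.eigenvalues k * Real.logb 2 (h.eigenvalues k) else 0

/-- A density matrix: positive semidefinite with unit trace. -/
def IsDensityMatrix {n : Type} [Fintype n] [DecidableEq n] (ρ : Matrix n n ℂ) : Prop :=
  ρ.PosSemidef ∧ ρ.trace = 1

/-- Partial trace over the B system. -/
def ptraceB {dA dB : ℕ} (ρ : Matrix (Fin dA × Fin dB) (Fin dA × Fin dB) ℂ) :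
    Matrix (Fin dA) (Fin dA) ℂ :=
  Matrix.of fun a a' => ∑ b, ρ (a, b) (a', b)

/-- Partial trace over the A system. -/
def ptraceA {dA dB : ℕ} (ρ : Matrix (Fin dA × Fin dB) (Fin dA × Fin dB) ℂ) :
    Matrix (Fin dB) (Fin dB) ℂ :=
  Matrix.of fun b b' => ∑ a, ρ (a, b) (a, b')

/-- A projective measurement on `ℂ^{dA}`: a finite family of mutually orthogonal
orthogonal projectors summing to the identity. -/
structure ProjMeas (dA m : ℕ) where
  P : Fin m → Matrix (Fin dA) (Fin dA) ℂ
  herm : ∀ i, (P i).IsHermitian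
  idem : ∀ i, P i * P i = P i
  orth : ∀ i j, i ≠ j → P i * P j = 0
  sum_eq : ∑ i, P i = 1

/-- A measurement is complete if all projectors are rank one. -/
def ProjMeas.Complete {dA m : ℕ} (M : ProjMeas dA m) : Prop :=
  ∀ i, (M.P i).rank = 1

/-- Outcome probability `p_i = Tr[(P_i ⊗ 1) ρ]`. -/
def prob {dA dB m : ℕ} (ρ : Matrix (Fin dA × Fin dB) (Fin dA × Fin dB) ℂ)
    (M : ProjMeas dA m) (i : Fin m) : ℝ :=
  (((M.P i ⊗ₖ (1 : Matrix (Fin dB) (Fin dB) ℂ)) * ρ).trace).re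

/-- Conditional state of Bob: `Tr_A[(P_i ⊗ 1) ρ (P_i ⊗ 1)] / p_i`. -/
def condB {dA dB m : ℕ} (ρ : Matrix (Fin dA × Fin dB) (Fin dA × Fin dB) ℂ)
    (M : ProjMeas dA m) (i : Fin m) : Matrix (Fin dB) (Fin dB) ℂ :=
  ((prob ρ M i : ℂ))⁻¹ •
    ptraceA ((M.P i ⊗ₖ (1 : Matrix (Fin dB) (Fin dB) ℂ)) * ρ *
      (M.P i ⊗ₖ (1 : Matrix (Fin dB) (Fin dB) ℂ)))

/-- `c_HV(ρ,{P_i}) = S(ρ_B) - ∑_i p_i S(ρ_i^B)`. -/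
def cHV {dA dB m : ℕ} (ρ : Matrix (Fin dA × Fin dB) (Fin dA × Fin dB) ℂ)
    (M : ProjMeas dA m) : ℝ :=
  vnEntropy (ptraceA ρ) - ∑ i, prob ρ M i * vnEntropy (condB ρ M i)

/-- Same, in bits. -/
def cHV2 {dA dB m : ℕ} (ρ : Matrix (Fin dA × Fin dB) (Fin dA × Fin dB) ℂ)
    (M : ProjMeas dA m) : ℝ :=
  vnEntropy2 (ptraceA ρ) - ∑ i, prob ρ M i * vnEntropy2 (condB ρ M i)

/-- Dephasing of a single-system state: `∑_i P_i σ P_i`. -/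
def deph {d m : ℕ} (σ : Matrix (Fin d) (Fin d) ℂ) (M : ProjMeas d m) :
    Matrix (Fin d) (Fin d) ℂ :=
  ∑ i, M.P i * σ * M.P i

/-- `δ_cl^→(ρ,{P_i}) = S(ρ_A) - S(ρ'_A) + c_HV(ρ,{P_i})`. -/
def deltaCl {dA dB m : ℕ} (ρ : Matrix (Fin dA × Fin dB) (Fin dA × Fin dB) ℂ)
    (M : ProjMeas dA m) : ℝ :=
  vnEntropy (ptraceB ρ) - vnEntropy (deph (ptraceB ρ) M) + cHV ρ M

/-- The Henderson–Vedral quantity: supremum of `c_HV` over complete projective measurements. -/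
def CHV {dA dB : ℕ} (ρ : Matrix (Fin dA × Fin dB) (Fin dA × Fin dB) ℂ) : ℝ :=
  sSup {x : ℝ | ∃ m, ∃ M : ProjMeas dA m, M.Complete ∧ x = cHV ρ M}

/-- One-way classical information deficit: supremum of `δ_cl^→` over complete
projective measurements. -/
def DeltaCl {dA dB : ℕ} (ρ : Matrix (Fin dA × Fin dB) (Fin dA × Fin dB) ℂ) : ℝ :=
  sSup {x : ℝ | ∃ m, ∃ M : ProjMeas dA m, M.Complete ∧ x = deltaCl ρ M}

/-- Alice-side dephasing of a bipartite state: `∑_i (P_i ⊗ 1) ρ (P_i ⊗ 1)`. -/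
def dephAB {dA dB m : ℕ} (ρ : Matrix (Fin dA × Fin dB) (Fin dA × Fin dB) ℂ)
    (M : ProjMeas dA m) : Matrix (Fin dA × Fin dB) (Fin dA × Fin dB) ℂ :=
  ∑ i, (M.P i ⊗ₖ (1 : Matrix (Fin dB) (Fin dB) ℂ)) * ρ *
    (M.P i ⊗ₖ (1 : Matrix (Fin dB) (Fin dB) ℂ))

/-- Outer product `|v⟩⟨v|`. -/
def outer {n : Type} [Fintype n] (v : n → ℂ) : Matrix n n ℂ :=
  Matrix.of fun x y => v x * star (v y)

/-- `Q` refines `P`: each projector of `P` is the sum of some of the projectors of `Q`. -/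
def Refines {dA m m' : ℕ} (Q : ProjMeas dA m') (P : ProjMeas dA m) : Prop :=
  ∃ f : Fin m' → Fin m, ∀ i, P.P i = ∑ j ∈ Finset.univ.filter (fun j => f j = i), Q.P j

/-- The expectation value `⟨e|A|e⟩` of a matrix in a vector, as a real number. -/
def expVal {d : ℕ} (A : Matrix (Fin d) (Fin d) ℂ) (e : EuclideanSpace ℂ (Fin d)) : ℝ :=
  (inner ℂ e (Matrix.toEuclideanLin A e)).re

lemma expVal_sum {d : ℕ} {ι : Type*} (s : Finset ι) (w : ι → ℝ)
    (A : ι → Matrix (Fin d) (Fin d) ℂ) (e : EuclideanSpace ℂ (Fin d)) :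
    expVal (∑ j ∈ s, (w j : ℂ) • A j) e = ∑ j ∈ s, w j * expVal (A j) e := by
  simp only [expVal, map_sum, map_smul, LinearMap.sum_apply, LinearMap.smul_apply, inner_sum,
    inner_smul_right, Complex.re_sum, Complex.re_ofReal_mul]

lemma toEuclideanLin_eigenvectorBasis {d : ℕ} {A : Matrix (Fin d) (Fin d) ℂ}
    (hA : A.IsHermitian) (l : Fin d) :
    Matrix.toEuclideanLin A (hA.eigenvectorBasis l)
      = (hA.eigenvalues l : ℂ) • hA.eigenvectorBasis l := by
  ext i
  have := congrFun (hA.mulVec_eigenvectorBasis l) i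
  simpa [Matrix.toLpLin_apply] using this

lemma expVal_eq_sum_eigenvalues {d : ℕ} {A : Matrix (Fin d) (Fin d) ℂ}
    (hA : A.IsHermitian) (e : EuclideanSpace ℂ (Fin d)) :
    expVal A e
      = ∑ l, ‖inner ℂ (hA.eigenvectorBasis l) e‖ ^ 2 * hA.eigenvalues l := by
  have hs : (Matrix.toEuclideanLin A).IsSymmetric := Matrix.isSymmetric_toEuclideanLin_iff.mpr hA
  unfold expVal
  rw [← OrthonormalBasis.sum_inner_mul_inner hA.eigenvectorBasis, Complex.re_sum]
  refine Finset.sum_congr rfl fun l _ => ?_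
  rw [← hs, toEuclideanLin_eigenvectorBasis, inner_smul_left, Complex.conj_ofReal,
    ← inner_conj_symm e, mul_left_comm, Complex.re_ofReal_mul, ← Complex.normSq_eq_conj_mul_self,
    Complex.ofReal_re, Complex.normSq_eq_norm_sq, mul_comm]

lemma expVal_eigenvectorBasis {d : ℕ} {A : Matrix (Fin d) (Fin d) ℂ}
    (hA : A.IsHermitian) (l : Fin d) :
    expVal A (hA.eigenvectorBasis l) = hA.eigenvalues l := by
  simp [expVal, toEuclideanLin_eigenvectorBasis]

lemma expVal_nonneg {d : ℕ} {A : Matrix (Fin d) (Fin d) ℂ} (hA : A.PosSemidef)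
    (e : EuclideanSpace ℂ (Fin d)) : 0 ≤ expVal A e := by
  rw [expVal_eq_sum_eigenvalues hA.1]
  exact Finset.sum_nonneg fun l _ => mul_nonneg (sq_nonneg _) (hA.eigenvalues_nonneg l)

lemma vnEntropy_eq {d : ℕ} {A : Matrix (Fin d) (Fin d) ℂ} (hA : A.IsHermitian) :
    vnEntropy A = ∑ k, Real.negMulLog (hA.eigenvalues k) := by
  simp [vnEntropy, hA, Real.negMulLog]

/-- The entropy is at most the Shannon entropy of the diagonal in any orthonormal basis. -/
lemma vnEntropy_le_sum_expVal {d : ℕ} {A : Matrix (Fin d) (Fin d) ℂ} (hA : A.PosSemidef)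
    (b : OrthonormalBasis (Fin d) ℂ (EuclideanSpace ℂ (Fin d))) :
    vnEntropy A ≤ ∑ k, Real.negMulLog (expVal A (b k)) := by
  have jensen (k : Fin d) :
      ∑ l, ‖inner ℂ (hA.1.eigenvectorBasis l) (b k)‖ ^ 2 * Real.negMulLog (hA.1.eigenvalues l)
        ≤ Real.negMulLog (expVal A (b k)) := by
    rw [expVal_eq_sum_eigenvalues hA.1]
    refine Real.concaveOn_negMulLog.le_map_sum (fun _ _ => sq_nonneg _) ?_
      (fun l _ => hA.eigenvalues_nonneg l)
    simp [OrthonormalBasis.sum_sq_norm_inner_right]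
  calc vnEntropy A
      = ∑ l, (∑ k, ‖inner ℂ (hA.1.eigenvectorBasis l) (b k)‖ ^ 2)
          * Real.negMulLog (hA.1.eigenvalues l) := by
        simp [vnEntropy_eq hA.1, OrthonormalBasis.sum_sq_norm_inner_left]
    _ = ∑ k, ∑ l, ‖inner ℂ (hA.1.eigenvectorBasis l) (b k)‖ ^ 2
          * Real.negMulLog (hA.1.eigenvalues l) := by
        simp_rw [Finset.sum_mul]
        exact Finset.sum_comm
    _ ≤ _ := Finset.sum_le_sum fun k _ => jensen k

/-- Concavity of the von Neumann entropy. -/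
lemma sum_mul_vnEntropy_le {d : ℕ} {ι : Type*} (s : Finset ι) (w : ι → ℝ)
    (A : ι → Matrix (Fin d) (Fin d) ℂ) (hw : ∀ j ∈ s, 0 ≤ w j) (hw1 : ∑ j ∈ s, w j = 1)
    (hA : ∀ j ∈ s, (A j).PosSemidef) :
    ∑ j ∈ s, w j * vnEntropy (A j) ≤ vnEntropy (∑ j ∈ s, (w j : ℂ) • A j) := by
  have hB : (∑ j ∈ s, (w j : ℂ) • A j).PosSemidef :=
    Matrix.posSemidef_sum s fun j hj => (hA j hj).smul (by exact_mod_cast hw j hj)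
  set b := hB.1.eigenvectorBasis
  calc ∑ j ∈ s, w j * vnEntropy (A j)
      ≤ ∑ j ∈ s, w j * ∑ k, Real.negMulLog (expVal (A j) (b k)) :=
        Finset.sum_le_sum fun j hj =>
          mul_le_mul_of_nonneg_left (vnEntropy_le_sum_expVal (hA j hj) b) (hw j hj)
    _ = ∑ k, ∑ j ∈ s, w j * Real.negMulLog (expVal (A j) (b k)) := by
        simp_rw [Finset.mul_sum]
        exact Finset.sum_comm
    _ ≤ ∑ k, Real.negMulLog (∑ j ∈ s, w j * expVal (A j) (b k)) :=
        Finset.sum_le_sum fun k _ => Real.concaveOn_negMulLog.le_map_sum hw hw1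
          fun j hj => expVal_nonneg (hA j hj) _
    _ = _ := by
        rw [vnEntropy_eq hB.1]
        refine Finset.sum_congr rfl fun k _ => ?_
        rw [← expVal_sum, expVal_eigenvectorBasis]

lemma ptraceA_add {dA dB : ℕ} (X Y : Matrix (Fin dA × Fin dB) (Fin dA × Fin dB) ℂ) :
    ptraceA (X + Y) = ptraceA X + ptraceA Y := by
  ext b b'
  simp [ptraceA, Finset.sum_add_distrib]

lemma trace_ptraceA {dA dB : ℕ} (X : Matrix (Fin dA × Fin dB) (Fin dA × Fin dB) ℂ) :
    (ptraceA X).trace = X.trace := by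
  simp only [ptraceA, Matrix.trace, Matrix.diag, Matrix.of_apply, Fintype.sum_prod_type]
  exact Finset.sum_comm

lemma ptraceA_posSemidef {dA dB : ℕ} {X : Matrix (Fin dA × Fin dB) (Fin dA × Fin dB) ℂ}
    (hX : X.PosSemidef) : (ptraceA X).PosSemidef := by
  have h : ptraceA X = ∑ a, X.submatrix (fun b => (a, b)) (fun b => (a, b)) := by
    ext b b'
    simp [ptraceA, Matrix.sum_apply]
  rw [h]
  exact Matrix.posSemidef_sum _ fun a _ => hX.submatrix _

lemma ptraceA_kronecker_mul_comm {dA dB : ℕ} (P : Matrix (Fin dA) (Fin dA) ℂ)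
    (X : Matrix (Fin dA × Fin dB) (Fin dA × Fin dB) ℂ) :
    ptraceA (X * (P ⊗ₖ (1 : Matrix (Fin dB) (Fin dB) ℂ)))
      = ptraceA ((P ⊗ₖ (1 : Matrix (Fin dB) (Fin dB) ℂ)) * X) := by
  ext b b'
  simp only [ptraceA, Matrix.of_apply, Matrix.mul_apply, Fintype.sum_prod_type,
    Matrix.kroneckerMap_apply, Matrix.one_apply, mul_ite, ite_mul, mul_one, mul_zero, zero_mul,
    Finset.sum_ite_eq, Finset.sum_ite_eq', Finset.mem_univ, if_true]
  rw [Finset.sum_comm]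
  simp_rw [mul_comm]

/-- Bob's subnormalized state `Tr_A[(P ⊗ 1) ρ]`. -/
def subB {dA dB : ℕ} (ρ : Matrix (Fin dA × Fin dB) (Fin dA × Fin dB) ℂ)
    (P : Matrix (Fin dA) (Fin dA) ℂ) : Matrix (Fin dB) (Fin dB) ℂ :=
  ptraceA ((P ⊗ₖ (1 : Matrix (Fin dB) (Fin dB) ℂ)) * ρ)

lemma subB_sum {dA dB : ℕ} (ρ : Matrix (Fin dA × Fin dB) (Fin dA × Fin dB) ℂ)
    {ι : Type*} (s : Finset ι) (P : ι → Matrix (Fin dA) (Fin dA) ℂ) :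
    subB ρ (∑ j ∈ s, P j) = ∑ j ∈ s, subB ρ (P j) := by
  let F : Matrix (Fin dA) (Fin dA) ℂ →+ Matrix (Fin dB) (Fin dB) ℂ :=
    AddMonoidHom.mk' (subB ρ) fun X Y => by
      simp only [subB, Matrix.add_kronecker, Matrix.add_mul, ptraceA_add]
  exact map_sum F P s

namespace ProjMeas

variable {dA dB m m' : ℕ} (ρ : Matrix (Fin dA × Fin dB) (Fin dA × Fin dB) ℂ)

lemma ptraceA_sandwich (M : ProjMeas dA m) (i : Fin m) :
    ptraceA ((M.P i ⊗ₖ (1 : Matrix (Fin dB) (Fin dB) ℂ)) * ρ *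
      (M.P i ⊗ₖ (1 : Matrix (Fin dB) (Fin dB) ℂ))) = subB ρ (M.P i) := by
  rw [ptraceA_kronecker_mul_comm, ← Matrix.mul_assoc, ← Matrix.mul_kronecker_mul, M.idem,
    Matrix.one_mul, subB]

lemma prob_eq (M : ProjMeas dA m) (i : Fin m) : prob ρ M i = (subB ρ (M.P i)).trace.re := by
  rw [prob, subB, trace_ptraceA]

lemma condB_eq (M : ProjMeas dA m) (i : Fin m) :
    condB ρ M i = ((prob ρ M i : ℂ))⁻¹ • subB ρ (M.P i) := by
  rw [condB, ptraceA_sandwich]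

variable {ρ}

lemma subB_posSemidef (hρ : ρ.PosSemidef) (M : ProjMeas dA m) (i : Fin m) :
    (subB ρ (M.P i)).PosSemidef := by
  rw [← ptraceA_sandwich]
  refine ptraceA_posSemidef ?_
  have h : (M.P i ⊗ₖ (1 : Matrix (Fin dB) (Fin dB) ℂ))ᴴ
      = M.P i ⊗ₖ (1 : Matrix (Fin dB) (Fin dB) ℂ) := by
    rw [Matrix.conjTranspose_kronecker, (M.herm i).eq, Matrix.conjTranspose_one]
  simpa only [h] using
    hρ.mul_mul_conjTranspose_same (M.P i ⊗ₖ (1 : Matrix (Fin dB) (Fin dB) ℂ))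

lemma prob_nonneg (hρ : ρ.PosSemidef) (M : ProjMeas dA m) (i : Fin m) : 0 ≤ prob ρ M i := by
  rw [prob_eq]
  exact (Complex.le_def.mp (M.subB_posSemidef hρ i).trace_nonneg).1

lemma ofReal_prob (hρ : ρ.PosSemidef) (M : ProjMeas dA m) (i : Fin m) :
    (prob ρ M i : ℂ) = (subB ρ (M.P i)).trace := by
  rw [prob_eq]
  exact (Complex.eq_re_of_ofReal_le (r := 0)
    (by simpa using (M.subB_posSemidef hρ i).trace_nonneg)).symm

lemma condB_posSemidef (hρ : ρ.PosSemidef) (M : ProjMeas dA m) (i : Fin m) :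
    (condB ρ M i).PosSemidef := by
  rw [condB_eq, ← Complex.ofReal_inv]
  exact (M.subB_posSemidef hρ i).smul
    (by exact_mod_cast inv_nonneg.mpr (M.prob_nonneg hρ i))

lemma prob_smul_condB (hρ : ρ.PosSemidef) (M : ProjMeas dA m) (i : Fin m) :
    (prob ρ M i : ℂ) • condB ρ M i = subB ρ (M.P i) := by
  rw [condB_eq]
  by_cases h : (prob ρ M i : ℂ) = 0
  · rw [h, zero_smul]
    rw [M.ofReal_prob hρ, (M.subB_posSemidef hρ i).trace_eq_zero_iff] at h
    exact h.symm
  · exact smul_inv_smul₀ h _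

/-- Refining a measurement does not increase Bob's average conditional entropy. -/
lemma sum_prob_mul_vnEntropy_le (hρ : ρ.PosSemidef) {P : ProjMeas dA m} {Q : ProjMeas dA m'}
    (h : Refines Q P) :
    ∑ j, prob ρ Q j * vnEntropy (condB ρ Q j) ≤ ∑ i, prob ρ P i * vnEntropy (condB ρ P i) := by
  obtain ⟨f, hf⟩ := h
  rw [← Finset.sum_fiberwise Finset.univ f]
  refine Finset.sum_le_sum fun i _ => ?_
  have hsub := congrArg (subB ρ) (hf i)
  rw [subB_sum] at hsub
  have hprob : prob ρ P i = ∑ j with f j = i, prob ρ Q j := by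
    simp only [prob_eq, hsub, Matrix.trace_sum, Complex.re_sum]
  rcases (P.prob_nonneg hρ i).eq_or_lt with h0 | hpos
  · have hz := (Finset.sum_eq_zero_iff_of_nonneg fun j _ => Q.prob_nonneg hρ j).mp
      (hprob.symm.trans h0.symm)
    rw [← h0, zero_mul]
    exact (Finset.sum_eq_zero fun j hj => by rw [hz j hj, zero_mul]).le
  · have hcond : condB ρ P i
        = ∑ j with f j = i, ((prob ρ Q j / prob ρ P i : ℝ) : ℂ) • condB ρ Q j := by
      rw [condB_eq, hsub, Finset.smul_sum]
      refine Finset.sum_congr rfl fun j _ => ?_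
      rw [← Q.prob_smul_condB hρ, smul_smul, Complex.ofReal_div, div_eq_inv_mul]
    have hconc := sum_mul_vnEntropy_le (Finset.univ.filter fun j => f j = i)
      (fun j => prob ρ Q j / prob ρ P i) (condB ρ Q)
      (fun j _ => div_nonneg (Q.prob_nonneg hρ j) hpos.le)
      (by rw [← Finset.sum_div, ← hprob, div_self hpos.ne'])
      (fun j _ => Q.condB_posSemidef hρ j)
    rw [← hcond] at hconc
    calc _ = prob ρ P i
          * ∑ j with f j = i, prob ρ Q j / prob ρ P i * vnEntropy (condB ρ Q j) := by
          rw [Finset.mul_sum]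
          refine Finset.sum_congr rfl fun j _ => ?_
          field_simp
      _ ≤ _ := mul_le_mul_of_nonneg_left hconc hpos.le

lemma deph_isHermitian (M : ProjMeas dA m) {σ : Matrix (Fin dA) (Fin dA) ℂ}
    (hσ : σ.IsHermitian) : (deph σ M).IsHermitian := by
  simp [Matrix.IsHermitian, deph, Matrix.conjTranspose_sum, Matrix.conjTranspose_mul,
    (M.herm _).eq, hσ.eq, Matrix.mul_assoc]

lemma mul_P (M : ProjMeas dA m) (i j : Fin m) :
    M.P i * M.P j = if i = j then M.P j else 0 := by
  split_ifs with h
  · rw [h, M.idem]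
  · exact M.orth i j h

lemma P_mul_deph (M : ProjMeas dA m) (σ : Matrix (Fin dA) (Fin dA) ℂ) (i : Fin m) :
    M.P i * deph σ M = M.P i * σ * M.P i := by
  simp [deph, Finset.mul_sum, ← Matrix.mul_assoc, mul_P, ite_mul]

lemma deph_mul_P (M : ProjMeas dA m) (σ : Matrix (Fin dA) (Fin dA) ℂ) (i : Fin m) :
    deph σ M * M.P i = M.P i * σ * M.P i := by
  simp [deph, Finset.sum_mul, Matrix.mul_assoc, mul_P, mul_ite]

/-- A measurement and a Hermitian matrix commuting with it have a common orthonormal eigenbasis. -/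
lemma exists_common_eigenbasis (M : ProjMeas dA m) {A : Matrix (Fin dA) (Fin dA) ℂ}
    (hA : A.IsHermitian) (hcomm : ∀ i, M.P i * A = A * M.P i) :
    ∃ (n : ℕ) (b : OrthonormalBasis (Fin n) ℂ (EuclideanSpace ℂ (Fin dA))) (f : Fin n → Fin m)
      (c : Fin n → ℂ), (∀ j, Matrix.toEuclideanLin A (b j) = c j • b j) ∧
        ∀ i j, Matrix.toEuclideanLin (M.P i) (b j) = if i = f j then b j else 0 := by
  let E := EuclideanSpace ℂ (Fin dA)
  let T : E →ₗ[ℂ] E := Matrix.toEuclideanLin A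
  let p (i : Fin m) : E →ₗ[ℂ] E := Matrix.toEuclideanLin (M.P i)
  have comp (X Y : Matrix (Fin dA) (Fin dA) ℂ) (x : E) :
      Matrix.toEuclideanLin X (Matrix.toEuclideanLin Y x) = Matrix.toEuclideanLin (X * Y) x := by
    simp [Matrix.toLpLin_apply]
  have hT : T.IsSymmetric := Matrix.isSymmetric_toEuclideanLin_iff.mpr hA
  have hp (i : Fin m) : (p i).IsSymmetric := Matrix.isSymmetric_toEuclideanLin_iff.mpr (M.herm i)
  have hpp (i k : Fin m) (x : E) : p i (p k x) = if i = k then p k x else 0 := by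
    simp only [p, comp, mul_P]
    split_ifs <;> simp
  let V (i : Fin m) : Submodule ℂ E := LinearMap.range (p i)
  have hpV (i k : Fin m) (x : E) (hx : x ∈ V k) : p i x = if i = k then x else 0 := by
    obtain ⟨y, rfl⟩ := hx
    exact hpp i k y
  have hV : OrthogonalFamily ℂ (fun i => V i) fun i => (V i).subtypeₗᵢ := by
    refine OrthogonalFamily.of_pairwise fun i k hik => ?_
    rintro x hx z ⟨y, rfl⟩
    rw [hp k, hpV k i x hx, if_neg hik.symm, inner_zero_right]
  have hint : DirectSum.IsInternal V := by
    rw [hV.isInternal_iff]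
    have : iSup V = ⊤ := by
      refine eq_top_iff.mpr fun x _ => ?_
      have hx : x = ∑ i, p i x := by
        rw [← LinearMap.sum_apply, ← map_sum, M.sum_eq]
        simp
      rw [hx]
      exact Submodule.sum_mem _ fun i _ => Submodule.mem_iSup_of_mem i ⟨x, rfl⟩
    rw [this, Submodule.top_orthogonal_eq_bot]
  have hinv (i : Fin m) : ∀ x ∈ V i, T x ∈ V i := by
    rintro _ ⟨y, rfl⟩
    refine ⟨T y, ?_⟩
    simp only [T, p, comp, hcomm]
  have hTi (i : Fin m) := hT.restrict_invariant (hinv i)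
  let c := hint.collectedOrthonormalBasis hV fun i => (hTi i).eigenvectorBasis rfl
  let e := Fintype.equivFin (Σ i, Fin (Module.finrank ℂ (V i)))
  have hc (a : Σ i, Fin (Module.finrank ℂ (V i))) :
      c a = ((hTi a.1).eigenvectorBasis rfl a.2 : E) := by
    simp [c, DirectSum.IsInternal.collectedOrthonormalBasis]
  refine ⟨_, c.reindex e, fun j => (e.symm j).1,
    fun j => (hTi (e.symm j).1).eigenvalues rfl (e.symm j).2, fun j => ?_, fun i j => ?_⟩
  · rw [OrthonormalBasis.reindex_apply, hc]
    exact congrArg Subtype.val ((hTi (e.symm j).1).apply_eigenvectorBasis rfl (e.symm j).2)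
  · rw [OrthonormalBasis.reindex_apply, hc]
    exact hpV i _ _ (Subtype.property _)

lemma _root_.OrthonormalBasis.star_dotProduct {n : ℕ}
    (b : OrthonormalBasis (Fin n) ℂ (EuclideanSpace ℂ (Fin dA))) (i j : Fin n) :
    star (b i : Fin dA → ℂ) ⬝ᵥ (b j : Fin dA → ℂ) = if i = j then 1 else 0 := by
  rw [dotProduct_comm, ← EuclideanSpace.inner_eq_star_dotProduct]
  exact orthonormal_iff_ite.mp b.orthonormal i j

/-- The complete measurement in an orthonormal basis. -/
def ofBasis {n : ℕ} (b : OrthonormalBasis (Fin n) ℂ (EuclideanSpace ℂ (Fin dA))) :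
    ProjMeas dA n where
  P j := Matrix.vecMulVec (b j) (star (b j : Fin dA → ℂ))
  herm j := by
    simp [Matrix.IsHermitian, Matrix.conjTranspose_vecMulVec]
  idem j := by
    simp [Matrix.vecMulVec_mul_vecMulVec, b.star_dotProduct]
  orth i j hij := by
    simp [Matrix.vecMulVec_mul_vecMulVec, b.star_dotProduct, hij]
  sum_eq := by
    refine Matrix.toEuclideanLin.injective (LinearMap.ext fun x => ?_)
    have h (j : Fin n) :
        Matrix.toEuclideanLin (Matrix.vecMulVec (b j) (star (b j : Fin dA → ℂ))) x
          = inner ℂ (b j) x • b j := by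
      ext i
      simp [Matrix.toLpLin_apply, Matrix.vecMulVec_mulVec,
        EuclideanSpace.inner_eq_star_dotProduct, dotProduct_comm, mul_comm]
    rw [map_sum, LinearMap.sum_apply, Finset.sum_congr rfl fun j _ => h j, b.sum_repr']
    simp

lemma ofBasis_complete {n : ℕ} (b : OrthonormalBasis (Fin n) ℂ (EuclideanSpace ℂ (Fin dA))) :
    (ofBasis b).Complete := by
  intro j
  have hb : (b j : Fin dA → ℂ) ≠ 0 := fun h => by
    simpa [h] using b.star_dotProduct j j
  refine le_antisymm (Matrix.rank_vecMulVec_le _ _) (Nat.one_le_iff_ne_zero.mpr fun h => ?_)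
  rw [Matrix.rank, Submodule.finrank_eq_zero, LinearMap.range_eq_bot] at h
  exact Matrix.vecMulVec_ne_zero hb (star_ne_zero.mpr hb)
    (Matrix.ext_of_mulVec_single fun i =>
      (LinearMap.congr_fun h (Pi.single i 1)).trans (Matrix.zero_mulVec _).symm)

lemma mul_ofBasis {n : ℕ} (b : OrthonormalBasis (Fin n) ℂ (EuclideanSpace ℂ (Fin dA)))
    {X : Matrix (Fin dA) (Fin dA) ℂ} {j : Fin n} {c : ℂ}
    (h : Matrix.toEuclideanLin X (b j) = c • b j) :
    X * (ofBasis b).P j = c • (ofBasis b).P j := by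
  have h' : X *ᵥ (b j : Fin dA → ℂ) = c • (b j : Fin dA → ℂ) := by
    simpa [Matrix.toLpLin_apply] using congrArg WithLp.ofLp h
  simp only [ofBasis]
  rw [Matrix.mul_vecMulVec, h', Matrix.smul_vecMulVec]

/-- Refining in an eigenbasis of the dephased state leaves the dephased state unchanged. -/
lemma exists_complete_refinement (M : ProjMeas dA m) {σ : Matrix (Fin dA) (Fin dA) ℂ}
    (hσ : σ.IsHermitian) :
    ∃ (n : ℕ) (Q : ProjMeas dA n), Q.Complete ∧ Refines Q M ∧ deph σ Q = deph σ M := by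
  obtain ⟨n, b, f, c, hc, hf⟩ := M.exists_common_eigenbasis (M.deph_isHermitian hσ)
    fun i => (M.P_mul_deph σ i).trans (M.deph_mul_P σ i).symm
  have hPQ (i : Fin m) (j : Fin n) :
      M.P i * (ofBasis b).P j = if f j = i then (ofBasis b).P j else 0 := by
    rw [mul_ofBasis b (c := if f j = i then 1 else 0)]
    · simp
    · simp [hf, eq_comm]
  have hQP (j : Fin n) : (ofBasis b).P j * M.P (f j) = (ofBasis b).P j := by
    simpa [((ofBasis b).herm j).eq, (M.herm (f j)).eq] using
      congrArg Matrix.conjTranspose (hPQ (f j) j)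
  refine ⟨n, ofBasis b, ofBasis_complete b, ⟨f, fun i => ?_⟩, ?_⟩
  · rw [← Matrix.mul_one (M.P i), ← (ofBasis b).sum_eq, Finset.mul_sum, Finset.sum_filter]
    exact Finset.sum_congr rfl fun j _ => hPQ i j
  · have key (j : Fin n) :
        (ofBasis b).P j * σ * (ofBasis b).P j = deph σ M * (ofBasis b).P j := by
      have hself : M.P (f j) * (ofBasis b).P j = (ofBasis b).P j := by simp [hPQ]
      calc (ofBasis b).P j * σ * (ofBasis b).P j
          = (ofBasis b).P j * (M.P (f j) * σ * M.P (f j)) * (ofBasis b).P j := by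
            simp only [Matrix.mul_assoc, hself]
            simp only [← Matrix.mul_assoc, hQP]
        _ = (ofBasis b).P j * (deph σ M * (ofBasis b).P j) := by
            rw [← M.deph_mul_P σ, Matrix.mul_assoc, Matrix.mul_assoc, hself]
        _ = _ := by
            rw [mul_ofBasis b (hc j), Matrix.mul_smul, (ofBasis b).idem]
    rw [deph, Finset.sum_congr rfl fun j _ => key j, ← Finset.mul_sum, (ofBasis b).sum_eq,
      Matrix.mul_one]

end ProjMeas

lemma ptraceB_isHermitian {dA dB : ℕ} {ρ : Matrix (Fin dA × Fin dB) (Fin dA × Fin dB) ℂ}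
    (hρ : ρ.IsHermitian) : (ptraceB ρ).IsHermitian := by
  ext a a'
  simp only [ptraceB, Matrix.conjTranspose_apply, Matrix.of_apply, star_sum]
  exact Finset.sum_congr rfl fun b _ => hρ.apply _ _

/-- every projective measurement admits a complete refinement that does
not decrease `δ_cl^→`; in particular the supremum over all projective measurements
equals the supremum over complete ones. -/
theorem deltaCl_refine {dA dB : ℕ}
    (ρ : Matrix (Fin dA × Fin dB) (Fin dA × Fin dB) ℂ) (hρ : IsDensityMatrix ρ) :
    (∀ (m : ℕ) (P : ProjMeas dA m), ∃ (m' : ℕ) (Q : ProjMeas dA m'),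
      Q.Complete ∧ Refines Q P ∧ deltaCl ρ Q ≥ deltaCl ρ P) ∧
    sSup {x : ℝ | ∃ (m : ℕ) (P : ProjMeas dA m), x = deltaCl ρ P} = DeltaCl ρ := by
  have hrefine : ∀ (m : ℕ) (P : ProjMeas dA m), ∃ (m' : ℕ) (Q : ProjMeas dA m'),
      Q.Complete ∧ Refines Q P ∧ deltaCl ρ Q ≥ deltaCl ρ P := by
    intro m P
    obtain ⟨n, Q, hQ, href, hdeph⟩ :=
      P.exists_complete_refinement (ptraceB_isHermitian hρ.1.isHermitian)
    refine ⟨n, Q, hQ, href, ?_⟩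
    have := ProjMeas.sum_prob_mul_vnEntropy_le hρ.1 href
    simp only [deltaCl, cHV, hdeph]
    linarith
  refine ⟨hrefine, ?_⟩
  have hsub : {x : ℝ | ∃ m, ∃ M : ProjMeas dA m, M.Complete ∧ x = deltaCl ρ M}
      ⊆ {x : ℝ | ∃ (m : ℕ) (P : ProjMeas dA m), x = deltaCl ρ P} :=
    fun x ⟨m, M, _, hx⟩ => ⟨m, M, hx⟩
  apply csSup_eq_csSup_of_forall_exists_le
  · rintro x ⟨m, P, rfl⟩
    obtain ⟨n, Q, hQ, -, hle⟩ := hrefine m P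
    exact ⟨_, ⟨n, Q, hQ, rfl⟩, hle⟩
  · exact fun x hx => ⟨x, hsub hx, le_rfl⟩

end
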